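/- Let X be a real random variable with finite variance, t > 0, and Y = X + √t·Z with Z ~ N(0,1) independent of X. Then the Fisher information of Y and the minimum mean-square error of estimating X from Y are related by J(X + √t·Z) = 1/t − E[(X − E[X|Y])²]/t². -/

import Mathlib

open MeasureTheory ProbabilityTheory Real

/-- The density of `X + √t·Z` (Gaussian smoothing of the law `μ` of `X` at time `t`):
`f_t(y) = ∫ (2πt)^{-1/2} · exp(-(y-x)²/(2t)) dμ(x)`. -/
noncomputable def heatDensity (μ : Measure ℝ) (t : ℝ) (y : ℝ) : ℝ :=
  ∫ x, (Real.sqrt (2 * Real.pi * t))⁻¹ * Real.exp (-(y - x) ^ 2 / (2 * t)) ∂μ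

open scoped NNReal

lemma measurable_gaussianPDFReal_uncurry (v : ℝ≥0) :
    Measurable fun p : ℝ × ℝ => gaussianPDFReal p.1 v p.2 := by
  unfold gaussianPDFReal
  fun_prop

lemma measurable_gaussianPDF_mean (v : ℝ≥0) (y : ℝ) :
    Measurable fun x => gaussianPDF x v y :=
  ((measurable_gaussianPDFReal_uncurry v).comp
    (measurable_id.prodMk measurable_const)).ennreal_ofReal

lemma gaussianPDFReal_le (x : ℝ) (v : ℝ≥0) (y : ℝ) :
    gaussianPDFReal x v y ≤ (√(2 * π * v))⁻¹ := by
  refine mul_le_of_le_one_right (by positivity) (Real.exp_le_one_iff.2 ?_)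
  exact div_nonpos_of_nonpos_of_nonneg (neg_nonpos.2 (sq_nonneg _)) (by positivity)

lemma integrable_gaussianPDFReal_mul {μ : Measure ℝ} {h : ℝ → ℝ} (hh : Integrable h μ)
    (v : ℝ≥0) (y : ℝ) : Integrable (fun x => gaussianPDFReal x v y * h x) μ := by
  refine hh.bdd_mul (c := (√(2 * π * v))⁻¹) ?_ (.of_forall fun x => ?_)
  · exact ((measurable_gaussianPDFReal_uncurry v).comp
      (measurable_id.prodMk measurable_const)).aestronglyMeasurable
  · rw [Real.norm_of_nonneg (gaussianPDFReal_nonneg _ _ _)]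
    exact gaussianPDFReal_le _ _ _

lemma integrable_gaussianPDFReal_mean (μ : Measure ℝ) [IsFiniteMeasure μ]
    (v : ℝ≥0) (y : ℝ) : Integrable (fun x => gaussianPDFReal x v y) μ := by
  simpa using integrable_gaussianPDFReal_mul (integrable_const (1 : ℝ)) v y

lemma heatDensity_pos (μ : Measure ℝ) [IsProbabilityMeasure μ] {v : ℝ≥0} (hv : v ≠ 0) (y : ℝ) :
    0 < heatDensity μ v y := by
  have hpos : 0 < (v : ℝ) := NNReal.coe_pos.2 (pos_iff_ne_zero.2 hv)
  rw [heatDensity, integral_const_mul]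
  refine mul_pos (by positivity) (integral_exp_pos ?_)
  have h := (integrable_gaussianPDFReal_mean μ v y).const_mul (√(2 * π * v))
  refine h.congr (.of_forall fun x => ?_)
  have : √(2 * π * v) ≠ 0 := by positivity
  simp only [gaussianPDFReal]
  field_simp

lemma abs_mul_gaussianPDFReal_le {v : ℝ≥0} (hv : v ≠ 0) (x y : ℝ) :
    |y - x| * gaussianPDFReal x v y ≤ (1 + 2 * v) * (√(2 * π * v))⁻¹ := by
  have hpos : 0 < (v : ℝ) := NNReal.coe_pos.2 (pos_iff_ne_zero.2 hv)
  have key : |y - x| * rexp (-(y - x) ^ 2 / (2 * v)) ≤ 1 + 2 * v := by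
    have h1 := Real.add_one_le_exp ((y - x) ^ 2 / (2 * v))
    have h2 : |y - x| ≤ (1 + 2 * v) * ((y - x) ^ 2 / (2 * v) + 1) := by
      have h3 : (1 + 2 * (v : ℝ)) * ((y - x) ^ 2 / (2 * v) + 1)
          = (y - x) ^ 2 / (2 * v) + (y - x) ^ 2 + 1 + 2 * v := by field_simp; ring
      rw [h3, ← sq_abs]
      have : 0 ≤ |y - x| ^ 2 / (2 * v) := by positivity
      nlinarith [sq_nonneg (|y - x| - 1), sq_nonneg (|y - x|)]
    rw [neg_div, Real.exp_neg, ← div_eq_mul_inv, div_le_iff₀ (Real.exp_pos _)]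
    exact h2.trans (by gcongr)
  calc |y - x| * gaussianPDFReal x v y
      = (|y - x| * rexp (-(y - x) ^ 2 / (2 * v))) * (√(2 * π * v))⁻¹ := by
        rw [gaussianPDFReal]; ring
    _ ≤ _ := by gcongr

/-- The numerator `∫ x φ_v(y - x) dμ(x)` of the posterior mean. -/
noncomputable def heatMoment (μ : Measure ℝ) (v : ℝ≥0) (y : ℝ) : ℝ :=
  ∫ x, gaussianPDFReal x v y * x ∂μ

lemma measurable_heatDensity (μ : Measure ℝ) [IsFiniteMeasure μ] (v : ℝ≥0) :
    Measurable (heatDensity μ v) :=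
  ((measurable_gaussianPDFReal_uncurry v).stronglyMeasurable.integral_prod_left' (μ := μ)).measurable

lemma measurable_heatMoment (μ : Measure ℝ) [IsFiniteMeasure μ] (v : ℝ≥0) :
    Measurable (heatMoment μ v) :=
  (((measurable_gaussianPDFReal_uncurry v).mul
    measurable_fst).stronglyMeasurable.integral_prod_left' (μ := μ)).measurable

/-- Tweedie's formula for the derivative of the smoothed density. -/
lemma hasDerivAt_heatDensity {μ : Measure ℝ} [IsFiniteMeasure μ] (hμ : Integrable id μ)
    {v : ℝ≥0} (hv : v ≠ 0) (y : ℝ) :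
    HasDerivAt (heatDensity μ v) ((heatMoment μ v y - y * heatDensity μ v y) / v) y := by
  have hpos : 0 < (v : ℝ) := NNReal.coe_pos.2 (pos_iff_ne_zero.2 hv)
  have hint1 : Integrable (fun x => gaussianPDFReal x v y * x) μ :=
    integrable_gaussianPDFReal_mul hμ v y
  have hint0 := integrable_gaussianPDFReal_mean μ v y
  have h := hasDerivAt_integral_of_dominated_loc_of_deriv_le (μ := μ) (𝕜 := ℝ) (x₀ := y)
    (F := fun y x => gaussianPDFReal x v y)
    (F' := fun y x => (gaussianPDFReal x v y * x - y * gaussianPDFReal x v y) / v)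
    (bound := fun _ => (1 + 2 * v) * (√(2 * π * v))⁻¹ / v) Filter.univ_mem
    (.of_forall fun z => (integrable_gaussianPDFReal_mean μ v z).aestronglyMeasurable) hint0
    ((hint1.sub (hint0.const_mul y)).div_const _).aestronglyMeasurable
    (.of_forall fun x z _ => ?_) (integrable_const _) (.of_forall fun x z _ => ?_)
  · refine h.2.congr_deriv ?_
    rw [integral_div, integral_sub hint1 (hint0.const_mul y), integral_const_mul]
    rfl
  · rw [norm_div, Real.norm_of_nonneg hpos.le]
    gcongr
    refine le_trans (le_of_eq ?_) (abs_mul_gaussianPDFReal_le hv x z)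
    rw [← abs_of_nonneg (gaussianPDFReal_nonneg x v z), ← abs_mul, Real.norm_eq_abs,
      abs_of_nonneg (gaussianPDFReal_nonneg x v z), abs_sub_comm, sub_mul, mul_comm x]
  · have h1 : HasDerivAt (fun z : ℝ => -(z - x) ^ 2 / (2 * v)) (-(z - x) / v) z := by
      have := ((((hasDerivAt_id z).sub_const x).pow 2).neg).div_const (2 * (v : ℝ))
      refine this.congr_deriv ?_
      simp only [id_eq]
      field_simp
      norm_num [mul_comm]
    have h2 := h1.exp.const_mul ((√(2 * π * v))⁻¹)
    refine h2.congr_deriv ?_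
    simp only [gaussianPDFReal]
    ring

section JointLaw

variable {Ω : Type*} [MeasurableSpace Ω] {P : Measure Ω} [IsProbabilityMeasure P] {X Y : Ω → ℝ}
  {v : ℝ≥0}

lemma map_add_sqrt_mul_gaussian {Z : Ω → ℝ} (hX : Measurable X) (hZ : Measurable Z)
    (hindep : IndepFun X Z P) (hZlaw : P.map Z = gaussianReal 0 1) (hv : v ≠ 0) :
    P.map (fun ω => (X ω, X ω + √v * Z ω)) =
      ((P.map X).prod volume).withDensity (fun p => gaussianPDF p.1 v p.2) := by
  have hprob : IsProbabilityMeasure (P.map X) := Measure.isProbabilityMeasure_map hX.aemeasurable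
  have hpdf : Measurable fun p : ℝ × ℝ => gaussianPDF p.1 v p.2 :=
    (measurable_gaussianPDFReal_uncurry v).ennreal_ofReal
  have hXZ := (indepFun_iff_map_prod_eq_prod_map_map hX.aemeasurable hZ.aemeasurable).1 hindep
  have hT : Measurable fun p : ℝ × ℝ => (p.1, p.1 + √v * p.2) := by fun_prop
  have hcomp : P.map (fun ω => (X ω, X ω + √v * Z ω)) =
      ((P.map X).prod (gaussianReal 0 1)).map (fun p : ℝ × ℝ => (p.1, p.1 + √v * p.2)) := by
    rw [← hZlaw, ← hXZ, Measure.map_map hT (hX.prodMk hZ)]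
    rfl
  refine Measure.ext_of_lintegral _ fun F hF => ?_
  rw [hcomp, lintegral_map hF hT, lintegral_prod _ (by fun_prop),
    lintegral_withDensity_eq_lintegral_mul _ hpdf hF,
    lintegral_prod _ (hpdf.mul hF).aemeasurable]
  refine lintegral_congr fun x => ?_
  have hx : (gaussianReal 0 1).map (fun z => x + √v * z) =
      volume.withDensity (gaussianPDF x v) := by
    rw [← gaussianReal_of_var_ne_zero x hv]
    have : (fun z => x + √v * z) = (fun z => x + z) ∘ (fun z => √v * z) := rfl
    rw [this, ← Measure.map_map (by fun_prop) (by fun_prop), gaussianReal_map_const_mul,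
      gaussianReal_map_const_add]
    congr 1
    · simp
    · ext; simp
  have hFx : Measurable fun y => F (x, y) := hF.comp measurable_prodMk_left
  calc ∫⁻ z, F (x, x + √v * z) ∂gaussianReal 0 1
      = ∫⁻ y, F (x, y) ∂(gaussianReal 0 1).map (fun z => x + √v * z) :=
        (lintegral_map hFx (by fun_prop)).symm
    _ = _ := by
        rw [hx, lintegral_withDensity_eq_lintegral_mul _ (measurable_gaussianPDF x v) hFx]
        rfl

lemma map_eq_withDensity_heatDensity (hX : Measurable X) (hY : Measurable Y)
    (hlaw : P.map (fun ω => (X ω, Y ω)) =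
      ((P.map X).prod volume).withDensity (fun p => gaussianPDF p.1 v p.2)) :
    P.map Y = volume.withDensity (fun y => ENNReal.ofReal (heatDensity (P.map X) v y)) := by
  have hprob : IsProbabilityMeasure (P.map X) := Measure.isProbabilityMeasure_map hX.aemeasurable
  have hpdf : Measurable fun p : ℝ × ℝ => gaussianPDF p.1 v p.2 :=
    (measurable_gaussianPDFReal_uncurry v).ennreal_ofReal
  have hsnd : P.map Y = (P.map (fun ω => (X ω, Y ω))).map Prod.snd := by
    rw [Measure.map_map measurable_snd (hX.prodMk hY)]
    rfl
  refine Measure.ext_of_lintegral _ fun F hF => ?_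
  have hF' : Measurable fun p : ℝ × ℝ => F p.2 := hF.comp measurable_snd
  rw [hsnd, lintegral_map hF measurable_snd, hlaw,
    lintegral_withDensity_eq_lintegral_mul _ hpdf hF',
    lintegral_prod_symm _ (hpdf.mul hF').aemeasurable,
    lintegral_withDensity_eq_lintegral_mul _ (measurable_heatDensity _ v).ennreal_ofReal hF]
  refine lintegral_congr fun y => ?_
  have hden : ∫⁻ x, gaussianPDF x v y ∂P.map X = ENNReal.ofReal (heatDensity (P.map X) v y) :=
    (ofReal_integral_eq_lintegral_ofReal (integrable_gaussianPDFReal_mean _ v y)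
      (.of_forall fun x => gaussianPDFReal_nonneg x v y)).symm
  exact (lintegral_mul_const (F y) (measurable_gaussianPDF_mean v y)).trans (congrArg (· * F y) hden)

/-- The posterior mean of `X` given `Y`, when `Y` is `X` plus Gaussian noise. -/
lemma condExp_eq_heatMoment_div_heatDensity (hX : Measurable X) (hY : Measurable Y)
    (hlaw : P.map (fun ω => (X ω, Y ω)) =
      ((P.map X).prod volume).withDensity (fun p => gaussianPDF p.1 v p.2))
    (hXint : Integrable X P) (hv : v ≠ 0) :
    P[X | MeasurableSpace.comap Y inferInstance] =ᵐ[P]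
      fun ω => heatMoment (P.map X) v (Y ω) / heatDensity (P.map X) v (Y ω) := by
  have hprob : IsProbabilityMeasure (P.map X) := Measure.isProbabilityMeasure_map hX.aemeasurable
  set μ := P.map X
  have hpdf : Measurable fun p : ℝ × ℝ => gaussianPDF p.1 v p.2 :=
    (measurable_gaussianPDFReal_uncurry v).ennreal_ofReal
  have hYlaw := map_eq_withDensity_heatDensity hX hY hlaw
  have hXY : Measurable fun ω => (X ω, Y ω) := hX.prodMk hY
  have hf := measurable_heatDensity μ v
  have hm : Measurable fun y => heatMoment μ v y / heatDensity μ v y :=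
    (measurable_heatMoment μ v).div hf
  have hfm (y : ℝ) : (ENNReal.ofReal (heatDensity μ v y)).toReal •
      (heatMoment μ v y / heatDensity μ v y) = heatMoment μ v y := by
    have := heatDensity_pos μ hv y
    rw [ENNReal.toReal_ofReal this.le, smul_eq_mul, mul_div_cancel₀ _ this.ne']
  have hpdfX (p : ℝ × ℝ) : (gaussianPDF p.1 v p.2).toReal • p.1 =
      gaussianPDFReal p.1 v p.2 * p.1 := by
    rw [gaussianPDF, ENNReal.toReal_ofReal (gaussianPDFReal_nonneg _ _ _), smul_eq_mul]
  have hjoint : Integrable (fun p : ℝ × ℝ => gaussianPDFReal p.1 v p.2 * p.1)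
      (μ.prod volume) := by
    have h1 : Integrable Prod.fst (P.map (fun ω => (X ω, Y ω))) :=
      (integrable_map_measure measurable_fst.aestronglyMeasurable hXY.aemeasurable).2 hXint
    rw [hlaw, integrable_withDensity_iff_integrable_smul' hpdf
      (.of_forall fun _ => ENNReal.ofReal_lt_top)] at h1
    simpa only [hpdfX] using h1
  have hmint : Integrable (fun ω => heatMoment μ v (Y ω) / heatDensity μ v (Y ω)) P := by
    refine (integrable_map_measure hm.aestronglyMeasurable hY.aemeasurable).1 ?_
    rw [hYlaw, integrable_withDensity_iff_integrable_smul' hf.ennreal_ofReal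
      (.of_forall fun _ => ENNReal.ofReal_lt_top)]
    simp only [hfm]
    exact hjoint.integral_prod_right
  refine (ae_eq_condExp_of_forall_setIntegral_eq hY.comap_le hXint
    (fun _ _ _ => hmint.integrableOn) ?_ ?_).symm
  · rintro _ ⟨A, hA, rfl⟩ -
    have hR : ∫ ω in Y ⁻¹' A, X ω ∂P = ∫ y in A, heatMoment μ v y := by
      have hset : Y ⁻¹' A = (fun ω => (X ω, Y ω)) ⁻¹' (Set.univ ×ˢ A) := by ext; simp
      rw [hset, ← setIntegral_map (MeasurableSet.univ.prod hA) (f := Prod.fst)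
        measurable_fst.aestronglyMeasurable hXY.aemeasurable, hlaw,
        setIntegral_withDensity_eq_setIntegral_toReal_smul hpdf
          (.of_forall fun _ => ENNReal.ofReal_lt_top) _ (MeasurableSet.univ.prod hA)]
      simp only [hpdfX]
      have hint := hjoint.integrableOn (s := Set.univ ×ˢ A)
      rw [IntegrableOn, ← Measure.prod_restrict, Measure.restrict_univ] at hint
      rw [← Measure.prod_restrict, Measure.restrict_univ, integral_prod_symm _ hint]
      rfl
    rw [hR, ← setIntegral_map hA (f := fun y => heatMoment μ v y / heatDensity μ v y)
      hm.aestronglyMeasurable hY.aemeasurable, hYlaw,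
      setIntegral_withDensity_eq_setIntegral_toReal_smul hf.ennreal_ofReal
        (.of_forall fun _ => ENNReal.ofReal_lt_top) _ hA]
    simp only [hfm]
  · exact (hm.comp (comap_measurable Y)).aestronglyMeasurable

end JointLaw

/-- Pythagoras for the conditional expectation: the mean-square distance from `X` to an
`m`-measurable `Y` splits through `E[X|m]`. -/
lemma integral_sub_sq_eq_add_condExp {Ω : Type*} {m m₀ : MeasurableSpace Ω} {P : Measure Ω}
    [IsProbabilityMeasure P] (hm : m ≤ m₀) {X Y : Ω → ℝ} (hX : MemLp X 2 P) (hY : MemLp Y 2 P)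
    (hYm : StronglyMeasurable[m] Y) :
    ∫ ω, (Y ω - X ω) ^ 2 ∂P =
      ∫ ω, ((P[X | m]) ω - Y ω) ^ 2 ∂P + ∫ ω, (X ω - (P[X | m]) ω) ^ 2 ∂P := by
  have hD : MemLp (P[X | m]) 2 P := hX.condExp one_le_two
  have hA := hD.sub hY
  have hB := hX.sub hD
  have hXint := hX.integrable one_le_two
  have hBint := hB.integrable one_le_two
  have hAB : Integrable ((P[X | m] - Y) * (X - P[X | m])) P := hA.integrable_mul hB
  have hzero : ∫ ω, ((P[X | m] - Y) * (X - P[X | m])) ω ∂P = 0 := by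
    have h1 := condExp_mul_of_stronglyMeasurable_left (m := m)
      (stronglyMeasurable_condExp.sub hYm) hAB hBint
    have h2 : P[X - P[X | m] | m] =ᵐ[P] 0 := by
      refine (condExp_sub hXint integrable_condExp m).trans ?_
      rw [condExp_of_stronglyMeasurable hm stronglyMeasurable_condExp integrable_condExp, sub_self]
    rw [← integral_condExp hm]
    refine integral_eq_zero_of_ae ?_
    filter_upwards [h1, h2] with ω h1 h2
    rw [h1, Pi.mul_apply, h2, Pi.zero_apply, mul_zero]
  have hsum : ∫ ω, (Y ω - X ω) ^ 2 ∂P = ∫ ω, (((P[X | m]) ω - Y ω) ^ 2 +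
      (X ω - (P[X | m]) ω) ^ 2 + 2 * ((P[X | m] - Y) * (X - P[X | m])) ω) ∂P := by
    refine integral_congr_ae (.of_forall fun ω => ?_)
    simp only [Pi.mul_apply, Pi.sub_apply]
    ring
  have hA2 : Integrable (fun ω => ((P[X | m]) ω - Y ω) ^ 2) P := hA.integrable_sq
  have hB2 : Integrable (fun ω => (X ω - (P[X | m]) ω) ^ 2) P := hB.integrable_sq
  rw [hsum, integral_add (by exact hA2.add hB2) (hAB.const_mul 2), integral_const_mul, hzero,
    integral_add hA2 hB2]
  ring

/-- Fisher information–MMSE relation: if `X` has finite variance, `t > 0`, and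
`Z ~ N(0,1)` is independent of `X`, then for `Y = X + √t·Z`,
`J(Y) = E[(f_Y'(Y)/f_Y(Y))²] = 1/t − E[(X − E[X|Y])²]/t²`. -/
theorem fisher_info_mmse_relation {Ω : Type*} [MeasurableSpace Ω] (P : Measure Ω)
    [IsProbabilityMeasure P] (X Z : Ω → ℝ) (hX : Measurable X) (hZ : Measurable Z)
    (hindep : IndepFun X Z P) (hZlaw : P.map Z = gaussianReal 0 1)
    (hX2 : Integrable (fun ω => (X ω) ^ 2) P)
    (t : ℝ) (ht : 0 < t) :
    (∫ ω, (deriv (heatDensity (P.map X) t) (X ω + Real.sqrt t * Z ω) /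
        heatDensity (P.map X) t (X ω + Real.sqrt t * Z ω)) ^ 2 ∂P) =
      1 / t - (∫ ω, (X ω -
          (P[X | MeasurableSpace.comap (fun ω => X ω + Real.sqrt t * Z ω)
            inferInstance]) ω) ^ 2 ∂P) / t ^ 2 := by
  lift t to ℝ≥0 using ht.le
  have hv : t ≠ 0 := by exact_mod_cast ht.ne'
  have hprob : IsProbabilityMeasure (P.map X) := Measure.isProbabilityMeasure_map hX.aemeasurable
  have hXL : MemLp X 2 P := (memLp_two_iff_integrable_sq hX.aestronglyMeasurable).2 hX2
  have hXint := hXL.integrable one_le_two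
  have hid : Integrable id (P.map X) :=
    (integrable_map_measure measurable_id.aestronglyMeasurable hX.aemeasurable).2 hXint
  have hZL : MemLp Z 2 P := by
    have h := memLp_id_gaussianReal (μ := 0) (v := 1) 2
    rw [← hZlaw] at h
    exact (memLp_map_measure_iff measurable_id.aestronglyMeasurable hZ.aemeasurable).1 h
  have hZ2 : ∫ ω, (Z ω) ^ 2 ∂P = 1 := by
    have h := variance_of_integral_eq_zero (μ := gaussianReal 0 1) aemeasurable_id
      (integral_id_gaussianReal (μ := 0) (v := 1))
    rw [variance_id_gaussianReal, ← hZlaw, integral_map hZ.aemeasurable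
      (by exact (measurable_id.pow_const 2).aestronglyMeasurable)] at h
    simpa using h.symm
  have hlaw := map_add_sqrt_mul_gaussian hX hZ hindep hZlaw hv
  have hY : Measurable fun ω => X ω + √t * Z ω := by fun_prop
  have hYL : MemLp (fun ω => X ω + √t * Z ω) 2 P := hXL.add (hZL.const_mul _)
  have hcond := condExp_eq_heatMoment_div_heatDensity hX hY hlaw hXint hv
  have hpyth := integral_sub_sq_eq_add_condExp hY.comap_le hXL hYL
    (comap_measurable _).stronglyMeasurable
  have hnoise : ∫ ω, (X ω + √t * Z ω - X ω) ^ 2 ∂P = t := by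
    simp only [add_sub_cancel_left, mul_pow, Real.sq_sqrt ht.le]
    rw [integral_const_mul, hZ2, mul_one]
  have hscore : ∫ ω, (deriv (heatDensity (P.map X) t) (X ω + √t * Z ω) /
        heatDensity (P.map X) t (X ω + √t * Z ω)) ^ 2 ∂P =
      (∫ ω, ((P[X | MeasurableSpace.comap (fun ω => X ω + √t * Z ω) inferInstance]) ω -
        (X ω + √t * Z ω)) ^ 2 ∂P) / t ^ 2 := by
    rw [← integral_div]
    refine integral_congr_ae ?_
    filter_upwards [hcond] with ω hω
    have hne := (heatDensity_pos (P.map X) hv (X ω + √t * Z ω)).ne'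
    rw [hω, (hasDerivAt_heatDensity hid hv _).deriv]
    field_simp
  rw [hnoise] at hpyth
  rw [hscore, div_sub_div _ _ ht.ne' (pow_ne_zero 2 ht.ne'),
    div_eq_div_iff (pow_ne_zero 2 ht.ne') (mul_ne_zero ht.ne' (pow_ne_zero 2 ht.ne'))]
  rw [eq_sub_of_add_eq hpyth.symm]
  ring
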